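/- Let (A,·,[·,·],α) be a Hom-F-manifold algebra over a field K of characteristic 0 with α bijective, α(x·y) = α(x)·α(y) and α([x,y]) = [α(x),α(y)] for all x,y ∈ A. Let (V;ρ,μ,φ) be a representation of A with φ bijective, and suppose in addition that, with L₃(x,y,u) = ρ(α(y))μ(x)u + ρ(α(x))μ(y)u − ρ(x·y)φ(u), the identities L₁(x·y, z, φ(u)) = L₁(α(y), z, μ(x)u) + L₁(α(x), z, μ(y)u) and μ(L(x,y,z))φ²(u) = L₃(α(y), α(z), μ(x)u) − μ(α(x))L₃(y,z,u) hold for all x,y,z ∈ A, u ∈ V. Define ρ★, μ★ : A → End(V*) by ⟨ρ★(x)ξ, v⟩ = −⟨ξ, φ⁻²(ρ(α(x))(v))⟩ and ⟨μ★(x)ξ, v⟩ = −⟨ξ, φ⁻²(μ(α(x))(v))⟩, and (φ⁻¹)* : V* → V* by ⟨(φ⁻¹)*ξ, v⟩ = ⟨ξ, φ⁻¹(v)⟩. Then (V*; ρ★, −μ★, (φ⁻¹)*) is a representation of the Hom-F-manifold algebra A. -/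

import Mathlib

/-- The Hom-Leibnizator `L(x,y,z) = [α(x), y·z] − [x,y]·α(z) − α(y)·[x,z]`. -/
def homLeib {A : Type*} [AddCommGroup A] (mul br : A → A → A) (α : A → A)
    (x y z : A) : A :=
  br (α x) (mul y z) - mul (br x y) (α z) - mul (α y) (br x z)

/-- `(A, mul, br, α)` is a Hom-F-manifold algebra. -/
def IsHomFManifold {A : Type*} [AddCommGroup A] (mul br : A → A → A) (α : A → A) : Prop :=
  (∀ x y, mul x y = mul y x) ∧
  (∀ x y z, mul (α x) (mul y z) = mul (mul x y) (α z)) ∧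
  (∀ x y, br x y = - br y x) ∧
  (∀ x y z, br (α x) (br y z) + br (α y) (br z x) + br (α z) (br x y) = 0) ∧
  (∀ x y z w, homLeib mul br α (mul x y) (α z) (α w) =
      mul (α (α x)) (homLeib mul br α y z w) + mul (α (α y)) (homLeib mul br α x z w))
/-- `L₁(x,y,u) = ρ(α(x))μ(y)u − μ(α(y))ρ(x)u − μ([x,y])φ(u)`. -/
def repL1 {A V : Type*} [AddCommGroup A] [AddCommGroup V]
    (br : A → A → A) (α : A → A) (ρ μ : A → V → V) (φ : V → V) (x y : A) (u : V) : V :=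
  ρ (α x) (μ y u) - μ (α y) (ρ x u) - μ (br x y) (φ u)

/-- `L₂(x,y,u) = μ(α(x))ρ(y)u + μ(α(y))ρ(x)u − ρ(x·y)φ(u)`. -/
def repL2 {A V : Type*} [AddCommGroup A] [AddCommGroup V]
    (mul : A → A → A) (α : A → A) (ρ μ : A → V → V) (φ : V → V) (x y : A) (u : V) : V :=
  μ (α x) (ρ y u) + μ (α y) (ρ x u) - ρ (mul x y) (φ u)

/-- `(V;ρ,μ,φ)` is a representation of the Hom-F-manifold algebra `(A,mul,br,α)`. -/
def IsHomFManifoldRep {A V : Type*} [AddCommGroup A] [AddCommGroup V]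
    (mul br : A → A → A) (α : A → A) (ρ μ : A → V → V) (φ : V → V) : Prop :=
  -- ρ is a representation of the Hom-Lie algebra (A,br,α)
  (∀ x v, ρ (α x) (φ v) = φ (ρ x v)) ∧
  (∀ x y v, ρ (br x y) (φ v) = ρ (α x) (ρ y v) - ρ (α y) (ρ x v)) ∧
  -- μ is a representation of the commutative Hom-associative algebra (A,mul,α)
  (∀ x v, μ (α x) (φ v) = φ (μ x v)) ∧
  (∀ x y v, μ (mul x y) (φ v) = μ (α x) (μ y v)) ∧
  -- the two compatibility conditions
  (∀ x y z u, repL1 br α ρ μ φ (mul x y) (α z) (φ u) =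
      μ (α (α x)) (repL1 br α ρ μ φ y z u) + μ (α (α y)) (repL1 br α ρ μ φ x z u)) ∧
  (∀ x y z u, μ (homLeib mul br α x y z) (φ (φ u)) =
      repL2 mul α ρ μ φ (α y) (α z) (μ x u) - μ (α (α x)) (repL2 mul α ρ μ φ y z u))

/-- `L₃(x,y,u) = ρ(α(y))μ(x)u + ρ(α(x))μ(y)u − ρ(x·y)φ(u)`. -/
def repL3 {A V : Type*} [AddCommGroup A] [AddCommGroup V]
    (mul : A → A → A) (α : A → A) (ρ μ : A → V → V) (φ : V → V) (x y : A) (u : V) : V :=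
  ρ (α y) (μ x u) + ρ (α x) (μ y u) - ρ (mul x y) (φ u)

/-- The "star" dual construction: `⟨(dualStar φinv g) ξ, v⟩ = −⟨ξ, φinv (φinv (g v))⟩`. -/
def dualStar {K V : Type*} [Field K] [AddCommGroup V] [Module K V]
    (φinv : V →ₗ[K] V) (g : V →ₗ[K] V) (ξ : Module.Dual K V) : Module.Dual K V :=
  -(ξ.comp ((φinv.comp φinv).comp g))

/-- If `L₁(x,y) = [r x, m y] - m [x,y]` satisfies both the left and the right Leibniz rule over a
commuting family `m`, then `[r y, m z]` commutes with every `m x`. -/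
theorem commute_commutator_of_leibniz {A R : Type*} [Ring R] [IsAddTorsionFree R]
    (r m : A → R) (p b : A → A → A) (hm : ∀ x y, m x * m y = m y * m x)
    (hleft : ∀ x y z, r (p x y) * m z - m z * r (p x y) - m (b (p x y) z) =
      m x * (r y * m z - m z * r y - m (b y z)) + m y * (r x * m z - m z * r x - m (b x z)))
    (hright : ∀ x y z, r (p x y) * m z - m z * r (p x y) - m (b (p x y) z) =
      (r y * m z - m z * r y - m (b y z)) * m x + (r x * m z - m z * r x - m (b x z)) * m y)
    (x y z : A) : (r y * m z - m z * r y) * m x = m x * (r y * m z - m z * r y) := by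
  have antisymm (x y z : A) : ⁅⁅r y, m z⁆, m x⁆ = -⁅⁅r x, m z⁆, m y⁆ := by
    have h := (hright x y z).symm.trans (hleft x y z)
    simp only [Ring.lie_def]
    linear_combination (norm := noncomm_ring) h + hm (b y z) x + hm (b x z) y
  have symm (x y z : A) : ⁅⁅r y, m z⁆, m x⁆ = ⁅⁅r y, m x⁆, m z⁆ := by
    simp only [Ring.lie_def]
    have h := hm x z
    have h₁ : r y * m z * m x = r y * m x * m z := by rw [mul_assoc, mul_assoc, h]
    have h₂ : m x * (m z * r y) = m z * (m x * r y) := by rw [← mul_assoc, ← mul_assoc, h]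
    simp only [sub_mul, mul_sub, h₁, h₂, mul_assoc]
    abel
  have h : ⁅⁅r y, m z⁆, m x⁆ = -⁅⁅r y, m z⁆, m x⁆ := by
    calc ⁅⁅r y, m z⁆, m x⁆ = -⁅⁅r x, m z⁆, m y⁆ := antisymm x y z
      _ = -⁅⁅r x, m y⁆, m z⁆ := by rw [symm]
      _ = ⁅⁅r z, m y⁆, m x⁆ := by rw [antisymm z x y, neg_neg]
      _ = ⁅⁅r z, m x⁆, m y⁆ := symm x z y
      _ = -⁅⁅r y, m x⁆, m z⁆ := antisymm y z x
      _ = -⁅⁅r y, m z⁆, m x⁆ := by rw [symm]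
  exact sub_eq_zero.mp (self_eq_neg.mp h)

/-- under the two extra coherence conditions, the dual
`(V*; ρ★, −μ★, (φ⁻¹)*)` of a representation `(V;ρ,μ,φ)` of a Hom-F-manifold algebra
is again a representation. -/
theorem homFManifold_dual_rep {K A V : Type*} [Field K] [CharZero K]
    [AddCommGroup A] [Module K A] [AddCommGroup V] [Module K V]
    (mul br : A →ₗ[K] A →ₗ[K] A) (α : A ≃ₗ[K] A)
    (hFM : IsHomFManifold (fun x y => mul x y) (fun x y => br x y) (fun x => α x))
    (hαm : ∀ x y : A, α (mul x y) = mul (α x) (α y))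
    (hαb : ∀ x y : A, α (br x y) = br (α x) (α y))
    (ρ μ : A → V →ₗ[K] V) (φ : V ≃ₗ[K] V)
    (hrep : IsHomFManifoldRep (fun x y => mul x y) (fun x y => br x y) (fun x => α x)
      (fun x v => ρ x v) (fun x v => μ x v) (fun v => φ v))
    (hcorep1 : ∀ (x y z : A) (u : V),
      repL1 (fun a b => br a b) (fun a => α a) (fun a v => ρ a v) (fun a v => μ a v)
          (fun v => φ v) (mul x y) z (φ u) =
        repL1 (fun a b => br a b) (fun a => α a) (fun a v => ρ a v) (fun a v => μ a v)
          (fun v => φ v) (α y) z (μ x u) +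
        repL1 (fun a b => br a b) (fun a => α a) (fun a v => ρ a v) (fun a v => μ a v)
          (fun v => φ v) (α x) z (μ y u))
    (hcorep2 : ∀ (x y z : A) (u : V),
      μ (homLeib (fun a b => mul a b) (fun a b => br a b) (fun a => α a) x y z) (φ (φ u)) =
        repL3 (fun a b => mul a b) (fun a => α a) (fun a v => ρ a v) (fun a v => μ a v)
          (fun v => φ v) (α y) (α z) (μ x u) -
        μ (α x) (repL3 (fun a b => mul a b) (fun a => α a) (fun a v => ρ a v)
          (fun a v => μ a v) (fun v => φ v) y z u)) :
    IsHomFManifoldRep (fun x y => mul x y) (fun x y => br x y) (fun x => α x)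
      (fun x ξ => dualStar φ.symm.toLinearMap (ρ (α x)) ξ)
      (fun x ξ => -(dualStar φ.symm.toLinearMap (μ (α x)) ξ))
      (fun ξ => ξ.comp φ.symm.toLinearMap) := by
  obtain ⟨hcomm, -, -, -, -⟩ := hFM
  obtain ⟨hρφ, hρ, hμφ, hμ, hL₁, hL₂⟩ := hrep
  have : IsAddTorsionFree (Module.End K V) := .of_isTorsionFree K _
  -- Undo the twists: every operation is a twist of an `α`- and `φ`-equivariant one.
  obtain ⟨r, hr⟩ : ∃ r : A → Module.End K V, ∀ x v, ρ x v = φ (r x v) :=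
    ⟨fun x => φ.symm.toLinearMap ∘ₗ ρ x, by simp⟩
  obtain ⟨m, hm⟩ : ∃ m : A → Module.End K V, ∀ x v, μ x v = φ (m x v) :=
    ⟨fun x => φ.symm.toLinearMap ∘ₗ μ x, by simp⟩
  obtain ⟨p, hp⟩ : ∃ p : A → A → A, ∀ x y, mul x y = α (p x y) :=
    ⟨fun x y => α.symm (mul x y), by simp⟩
  obtain ⟨b, hb⟩ : ∃ b : A → A → A, ∀ x y, br x y = α (b x y) :=
    ⟨fun x y => α.symm (br x y), by simp⟩
  obtain ⟨l, hl⟩ : ∃ l : A → A → A → A, ∀ x y z,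
      homLeib (fun a b => mul a b) (fun a b => br a b) (fun a => α a) x y z = α (α (l x y z)) :=
    ⟨fun x y z => α.symm (α.symm (homLeib (fun a b => mul a b) (fun a b => br a b)
      (fun a => α a) x y z)), by simp⟩
  have hpα (x y : A) : p (α x) (α y) = α (p x y) := α.injective (by rw [← hp, ← hp, hαm])
  have hbα (x y : A) : b (α x) (α y) = α (b x y) := α.injective (by rw [← hb, ← hb, hαb])
  have hp_comm (x y : A) : p x y = p y x := α.injective (by rw [← hp, ← hp]; exact hcomm x y)
  have hrφ (x : A) (v : V) : r (α x) (φ v) = φ (r x v) :=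
    φ.injective (by simpa only [hr] using hρφ x v)
  have hmφ (x : A) (v : V) : m (α x) (φ v) = φ (m x v) :=
    φ.injective (by simpa only [hm] using hμφ x v)
  simp only [hl] at hL₂
  simp only [repL1, repL2, hr, hm, hp, hb, hpα, hbα, hrφ, hmφ, ← map_add, ← map_sub,
    φ.injective.eq_iff] at hρ hμ hL₁ hL₂
  have hright (x y z : A) (u : V) := hcorep1 x y (α z) u
  simp only [repL1, hr, hm, hp, hb, hbα, hrφ, hmφ, ← map_add, ← map_sub,
    φ.injective.eq_iff] at hright
  have hm_comm (x y : A) : m x * m y = m y * m x :=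
    LinearMap.ext fun v => by
      rw [Module.End.mul_apply, Module.End.mul_apply, ← hμ, hp_comm, hμ]
  have hcommute (x y z : A) (v : V) := LinearMap.congr_fun
    (commute_commutator_of_leibniz r m p b hm_comm
      (fun x y z => LinearMap.ext fun v => by
        simpa using hL₁ x y z v)
      (fun x y z => LinearMap.ext fun v => by
        simpa using hright x y z v) x y z) v
  simp only [Module.End.mul_apply, LinearMap.sub_apply, map_sub] at hcommute
  have hL₃ (x y z : A) (v : V) : m (l x y z) v =
      r z (m y (m x v)) + r y (m z (m x v)) - r (p y z) (m x v)
        - m x (r z (m y v) + r y (m z v) - r (p y z) v) := by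
    have h₁ := hcommute x y z v
    have h₂ := hcommute x z y v
    rw [hL₂]
    simp only [map_add, map_sub]
    linear_combination (norm := abel) - h₁ - h₂
  have hφ (v : V) : ∃ w, φ (φ (φ w)) = v := ⟨φ.symm (φ.symm (φ.symm v)), by simp⟩
  have hrs (x : A) (v : V) : φ.symm (r (α x) v) = r x (φ.symm v) := by
    rw [φ.symm_apply_eq, ← hrφ, φ.apply_symm_apply]
  have hms (x : A) (v : V) : φ.symm (m (α x) v) = m x (φ.symm v) := by
    rw [φ.symm_apply_eq, ← hmφ, φ.apply_symm_apply]
  have hρstar (x : A) (ξ : Module.Dual K V) (v : V) :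
      dualStar φ.symm.toLinearMap (ρ (α x)) ξ v = -ξ (r x (φ.symm v)) := by
    simp [dualStar, hr, hrs]
  have hμstar (x : A) (ξ : Module.Dual K V) (v : V) :
      dualStar φ.symm.toLinearMap (μ (α x)) ξ v = -ξ (m x (φ.symm v)) := by
    simp [dualStar, hm, hms]
  have hcomp (ξ : Module.Dual K V) (v : V) : ξ.comp φ.symm.toLinearMap v = ξ (φ.symm v) := rfl
  simp only [IsHomFManifoldRep, hl]
  refine ⟨fun x ξ => ?_, fun x y ξ => ?_, fun x ξ => ?_, fun x y ξ => ?_,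
    fun x y z ξ => ?_, fun x y z ξ => ?_⟩ <;> ext v <;> obtain ⟨w, rfl⟩ := hφ v <;>
    simp only [repL1, repL2, hp, hb, hpα, hbα, hρstar, hμstar, hcomp, LinearMap.neg_apply,
      LinearMap.add_apply, LinearMap.sub_apply, hrφ, hmφ, φ.symm_apply_apply, neg_neg]
  · rw [hρ, map_sub]; ring
  · rw [hp_comm, hμ]
  · have h := congrArg ξ (hright x y z w)
    simp only [map_add, map_sub] at h
    linear_combination h
  · have h := congrArg ξ (hL₃ x y z w)
    simp only [map_add, map_sub] at h
    linear_combination h
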